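/- (Dual form of the multilinear Pitt inequality.) Let m,n ≥ 1, 0 < α_k < n, α = Σ α_k with (m−1)n < α < mn, and β = α − (m−1)n. Then for every nonnegative measurable function g on ℝ^n, ∫_{(ℝ^n)^m} (∫_{ℝ^n} Π_{k=1}^m |y_k−x|^{−(n−α_k/2)} · |x|^{−β/2} g(x) dx)² dy_1⋯dy_m ≤ D_β · ∫_{ℝ^n} g(x)² dx, where D_β = π^{(m+1)n/2} · Π_{k=1}^m [Γ(α_k/4)² Γ((n−α_k)/2) / (Γ((2n−α_k)/4)² Γ(α_k/2))] · [Γ(β/2)/Γ((n−β)/2)] · [Γ((n−β)/4)/Γ((n+β)/4)]². -/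

import Mathlib

open MeasureTheory Real
open scoped ENNReal

noncomputable section

lemma lintegral_rpow_mul_exp_neg_mul_Ioi {q c : ℝ} (hq : 0 < q) (hc : 0 < c) :
    ∫⁻ t in Set.Ioi (0 : ℝ), ENNReal.ofReal (t ^ (q - 1) * exp (-(c * t))) =
      ENNReal.ofReal (Gamma q * c ^ (-q)) := by
  have h := integral_rpow_mul_exp_neg_mul_Ioi hq hc
  rw [← ofReal_integral_eq_lintegral_ofReal, h, one_div, inv_rpow hc.le, rpow_neg hc.le, mul_comm]
  · refine Integrable.of_integral_ne_zero ?_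
    rw [h]
    have := Gamma_pos_of_pos hq
    positivity
  · filter_upwards [ae_restrict_mem measurableSet_Ioi] with t ht
    have : (0 : ℝ) < t := ht
    positivity

/-- Feynman's parametrization of a product of two powers. -/
lemma lintegral_rpow_mul_add_mul_rpow {p q A B : ℝ} (hp : 0 < p) (hpq : p < q) (hA : 0 < A)
    (hB : 0 < B) :
    ∫⁻ u in Set.Ioi (0 : ℝ), ENNReal.ofReal (u ^ (p - 1) * (A + u * B) ^ (-q)) =
      ENNReal.ofReal (Gamma p * Gamma (q - p) / Gamma q * (A ^ (p - q) * B ^ (-p))) := by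
  have hΓp := Gamma_pos_of_pos hp
  have hΓq := Gamma_pos_of_pos (hp.trans hpq)
  have hΓ := Gamma_pos_of_pos (sub_pos.2 hpq)
  have left : ∀ u ∈ Set.Ioi (0 : ℝ), ENNReal.ofReal (u ^ (p - 1) * (A + u * B) ^ (-q)) =
      ENNReal.ofReal (Gamma q)⁻¹ * ∫⁻ s in Set.Ioi (0 : ℝ),
        ENNReal.ofReal (u ^ (p - 1)) * ENNReal.ofReal (s ^ (q - 1) * exp (-((A + u * B) * s))) := by
    intro u hu
    have hu : 0 < u := hu
    rw [lintegral_const_mul _ (by fun_prop),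
      lintegral_rpow_mul_exp_neg_mul_Ioi (hp.trans hpq) (by positivity),
      ← ENNReal.ofReal_mul (by positivity), ← ENNReal.ofReal_mul (by positivity)]
    congr 1
    field_simp
  have right : ∀ s ∈ Set.Ioi (0 : ℝ), ∫⁻ u in Set.Ioi (0 : ℝ),
        ENNReal.ofReal (u ^ (p - 1)) * ENNReal.ofReal (s ^ (q - 1) * exp (-((A + u * B) * s))) =
      ENNReal.ofReal (Gamma p * B ^ (-p)) *
        ENNReal.ofReal (s ^ (q - p - 1) * exp (-(A * s))) := by
    intro s hs
    have hs : 0 < s := hs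
    calc
      _ = ∫⁻ u in Set.Ioi (0 : ℝ), ENNReal.ofReal (s ^ (q - 1) * exp (-(A * s))) *
            ENNReal.ofReal (u ^ (p - 1) * exp (-((s * B) * u))) := by
        refine setLIntegral_congr_fun measurableSet_Ioi fun u hu => ?_
        have hu : 0 < u := hu
        rw [← ENNReal.ofReal_mul (by positivity), ← ENNReal.ofReal_mul (by positivity),
          show -((A + u * B) * s) = -(A * s) + -(s * B * u) by ring, exp_add]
        ring_nf
      _ = _ := by
        rw [lintegral_const_mul _ (by fun_prop),
          lintegral_rpow_mul_exp_neg_mul_Ioi hp (by positivity),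
          ← ENNReal.ofReal_mul (by positivity), ← ENNReal.ofReal_mul (by positivity),
          mul_rpow hs.le hB.le, show q - p - 1 = (q - 1) + -p by ring, rpow_add hs]
        ring_nf
  rw [setLIntegral_congr_fun measurableSet_Ioi left, lintegral_const_mul' _ _ ENNReal.ofReal_ne_top,
    lintegral_lintegral_swap (by fun_prop), setLIntegral_congr_fun measurableSet_Ioi right,
    lintegral_const_mul _ (by fun_prop), lintegral_rpow_mul_exp_neg_mul_Ioi (sub_pos.2 hpq) hA,
    ← ENNReal.ofReal_mul (by positivity), ← ENNReal.ofReal_mul (by positivity), neg_sub]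
  congr 1
  field_simp

variable {n : ℕ}

lemma lintegral_exp_neg_mul_norm_sub_sq {b : ℝ} (hb : 0 < b) (c : EuclideanSpace ℝ (Fin n)) :
    ∫⁻ y, ENNReal.ofReal (exp (-(b * ‖y - c‖ ^ 2))) =
      ENNReal.ofReal ((π / b) ^ ((n : ℝ) / 2)) := by
  rw [lintegral_sub_right_eq_self
    (fun y : EuclideanSpace ℝ (Fin n) => ENNReal.ofReal (exp (-(b * ‖y‖ ^ 2)))) c]
  have h := GaussianFourier.integral_rexp_neg_mul_sq_norm (V := EuclideanSpace ℝ (Fin n)) hb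
  simp only [finrank_euclideanSpace, Fintype.card_fin, neg_mul] at h
  rw [← ofReal_integral_eq_lintegral_ofReal, h]
  · refine Integrable.of_integral_ne_zero ?_
    rw [h]
    positivity
  · filter_upwards with t using by positivity

lemma lintegral_add_mul_norm_sub_sq_rpow {q A B : ℝ} (hq : (n : ℝ) / 2 < q) (hA : 0 < A)
    (hB : 0 < B) (c : EuclideanSpace ℝ (Fin n)) :
    ∫⁻ y, ENNReal.ofReal ((A + B * ‖y - c‖ ^ 2) ^ (-q)) =
      ENNReal.ofReal (π ^ ((n : ℝ) / 2) * Gamma (q - n / 2) / Gamma q *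
        (A ^ ((n : ℝ) / 2 - q) * B ^ (-((n : ℝ) / 2)))) := by
  have hq0 : 0 < q := lt_of_le_of_lt (by positivity) hq
  have hΓq := Gamma_pos_of_pos hq0
  have hΓ := Gamma_pos_of_pos (sub_pos.2 hq)
  have left : ∀ y : EuclideanSpace ℝ (Fin n), ENNReal.ofReal ((A + B * ‖y - c‖ ^ 2) ^ (-q)) =
      ENNReal.ofReal (Gamma q)⁻¹ * ∫⁻ s in Set.Ioi (0 : ℝ),
        ENNReal.ofReal (s ^ (q - 1) * exp (-((A + B * ‖y - c‖ ^ 2) * s))) := by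
    intro y
    rw [lintegral_rpow_mul_exp_neg_mul_Ioi hq0 (by positivity),
      ← ENNReal.ofReal_mul (by positivity)]
    congr 1
    field_simp
  have right : ∀ s ∈ Set.Ioi (0 : ℝ), ∫⁻ y : EuclideanSpace ℝ (Fin n),
        ENNReal.ofReal (s ^ (q - 1) * exp (-((A + B * ‖y - c‖ ^ 2) * s))) =
      ENNReal.ofReal ((π / B) ^ ((n : ℝ) / 2)) *
        ENNReal.ofReal (s ^ (q - n / 2 - 1) * exp (-(A * s))) := by
    intro s hs
    have hs : 0 < s := hs
    calc
      _ = ∫⁻ y : EuclideanSpace ℝ (Fin n), ENNReal.ofReal (s ^ (q - 1) * exp (-(A * s))) *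
            ENNReal.ofReal (exp (-((s * B) * ‖y - c‖ ^ 2))) := by
        refine lintegral_congr fun y => ?_
        rw [← ENNReal.ofReal_mul (by positivity), mul_assoc, ← exp_add]
        ring_nf
      _ = _ := by
        rw [lintegral_const_mul _ (by fun_prop),
          lintegral_exp_neg_mul_norm_sub_sq (by positivity),
          ← ENNReal.ofReal_mul (by positivity), ← ENNReal.ofReal_mul (by positivity),
          show q - (n : ℝ) / 2 - 1 = (q - 1) + -(n / 2) by ring, rpow_add hs,
          show π / (s * B) = s⁻¹ * (π / B) by field_simp, mul_rpow (by positivity) (by positivity),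
          inv_rpow hs.le, rpow_neg hs.le]
        ring_nf
  rw [lintegral_congr left, lintegral_const_mul' _ _ ENNReal.ofReal_ne_top,
    lintegral_lintegral_swap (by fun_prop), setLIntegral_congr_fun measurableSet_Ioi right,
    lintegral_const_mul _ (by fun_prop), lintegral_rpow_mul_exp_neg_mul_Ioi (sub_pos.2 hq) hA,
    ← ENNReal.ofReal_mul (by positivity), ← ENNReal.ofReal_mul (by positivity), neg_sub,
    div_rpow pi_pos.le hB.le, rpow_neg hB.le]
  congr 1
  field_simp

lemma norm_sub_sq_add_mul_norm_sub_sq {V : Type*} [NormedAddCommGroup V] [InnerProductSpace ℝ V]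
    {u : ℝ} (hu : 0 < u) (x y z : V) :
    ‖y - x‖ ^ 2 + u * ‖y - z‖ ^ 2 =
      u / (1 + u) * ‖x - z‖ ^ 2 + (1 + u) * ‖y - (1 + u)⁻¹ • (x + u • z)‖ ^ 2 := by
  simp only [norm_sub_sq_real, norm_add_sq_real, norm_smul, inner_smul_right, inner_add_right,
    mul_pow, norm_inv, Real.norm_eq_abs, sq_abs, inv_pow]
  field_simp
  ring

/-- The composition formula for Riesz kernels. -/
lemma lintegral_norm_sub_rpow_mul_norm_sub_rpow (hn : 1 ≤ n) {a b : ℝ} (ha : a < n) (hb : b < n)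
    (hab : n < a + b) {x z : EuclideanSpace ℝ (Fin n)} (hxz : x ≠ z) :
    ∫⁻ y, ENNReal.ofReal (‖y - x‖ ^ (-a) * ‖y - z‖ ^ (-b)) =
      ENNReal.ofReal (π ^ ((n : ℝ) / 2) *
        (Gamma ((n - a) / 2) * Gamma ((n - b) / 2) * Gamma ((a + b - n) / 2) /
          (Gamma (a / 2) * Gamma (b / 2) * Gamma ((2 * n - a - b) / 2))) *
        ‖x - z‖ ^ (n - a - b)) := by
  have : Nonempty (Fin n) := ⟨⟨0, hn⟩⟩
  have ha0 : 0 < a := by linarith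
  have hb0 : 0 < b := by linarith
  have hr : 0 < ‖x - z‖ := norm_pos_iff.2 (sub_ne_zero.2 hxz)
  have h₁ := Gamma_pos_of_pos (half_pos ha0)
  have h₂ := Gamma_pos_of_pos (half_pos hb0)
  have h₃ := Gamma_pos_of_pos (show 0 < (a + b) / 2 by linarith)
  have h₄ := Gamma_pos_of_pos (show 0 < (n - a) / 2 by linarith)
  have h₅ := Gamma_pos_of_pos (show 0 < (n - b) / 2 by linarith)
  have h₆ := Gamma_pos_of_pos (show 0 < (a + b - n) / 2 by linarith)
  have h₇ := Gamma_pos_of_pos (show 0 < (2 * n - a - b) / 2 by linarith)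
  have left : ∀ᵐ y : EuclideanSpace ℝ (Fin n),
      ENNReal.ofReal (‖y - x‖ ^ (-a) * ‖y - z‖ ^ (-b)) =
        ENNReal.ofReal (Gamma ((a + b) / 2) / (Gamma (a / 2) * Gamma (b / 2))) *
          ∫⁻ u in Set.Ioi (0 : ℝ), ENNReal.ofReal
            (u ^ (b / 2 - 1) * (‖y - x‖ ^ 2 + u * ‖y - z‖ ^ 2) ^ (-((a + b) / 2))) := by
    filter_upwards [Measure.ae_ne volume x, Measure.ae_ne volume z] with y hyx hyz
    have hx : 0 < ‖y - x‖ := norm_pos_iff.2 (sub_ne_zero.2 hyx)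
    have hz : 0 < ‖y - z‖ := norm_pos_iff.2 (sub_ne_zero.2 hyz)
    rw [lintegral_rpow_mul_add_mul_rpow (by linarith) (by linarith) (by positivity)
      (by positivity), ← ENNReal.ofReal_mul (by positivity), ← rpow_natCast, ← rpow_natCast,
      ← rpow_mul hx.le, ← rpow_mul hz.le]
    congr 1
    rw [show (a + b) / 2 - b / 2 = a / 2 by ring,
      show ((2 : ℕ) : ℝ) * (b / 2 - (a + b) / 2) = -a by push_cast; ring,
      show ((2 : ℕ) : ℝ) * -(b / 2) = -b by push_cast; ring]
    field_simp
  have right : ∀ u ∈ Set.Ioi (0 : ℝ), ∫⁻ y : EuclideanSpace ℝ (Fin n), ENNReal.ofReal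
        (u ^ (b / 2 - 1) * (‖y - x‖ ^ 2 + u * ‖y - z‖ ^ 2) ^ (-((a + b) / 2))) =
      ENNReal.ofReal (π ^ ((n : ℝ) / 2) * Gamma ((a + b - n) / 2) / Gamma ((a + b) / 2) *
        ‖x - z‖ ^ (n - a - b)) *
        ENNReal.ofReal (u ^ ((n - a) / 2 - 1) * (1 + u * 1) ^ (-((2 * n - a - b) / 2))) := by
    intro u hu
    have hu : 0 < u := hu
    simp only [norm_sub_sq_add_mul_norm_sub_sq hu x _ z]
    simp only [ENNReal.ofReal_mul (rpow_nonneg hu.le (b / 2 - 1))]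
    rw [lintegral_const_mul _ (by fun_prop),
      lintegral_add_mul_norm_sub_sq_rpow (by linarith) (by positivity) (by positivity),
      ← ENNReal.ofReal_mul (by positivity), ← ENNReal.ofReal_mul (by positivity),
      mul_rpow (by positivity) (by positivity), ← rpow_natCast, ← rpow_mul hr.le,
      div_rpow hu.le (by positivity), div_eq_mul_inv (u ^ _), ← rpow_neg (by positivity),
      show (a + b) / 2 - (n : ℝ) / 2 = (a + b - n) / 2 by ring,
      show ((2 : ℕ) : ℝ) * ((n : ℝ) / 2 - (a + b) / 2) = n - a - b by push_cast; ring,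
      show ((n : ℝ) - a) / 2 - 1 = (b / 2 - 1) + (n / 2 - (a + b) / 2) by ring, rpow_add hu,
      show -((2 * (n : ℝ) - a - b) / 2) = -(n / 2 - (a + b) / 2) + -(n / 2) by ring, mul_one,
      rpow_add (by positivity)]
    ring_nf
  rw [lintegral_congr_ae left, lintegral_const_mul' _ _ ENNReal.ofReal_ne_top,
    lintegral_lintegral_swap (by fun_prop), setLIntegral_congr_fun measurableSet_Ioi right,
    lintegral_const_mul _ (by fun_prop),
    lintegral_rpow_mul_add_mul_rpow (by linarith) (by linarith) one_pos one_pos,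
    ← ENNReal.ofReal_mul (by positivity), ← ENNReal.ofReal_mul (by positivity),
    show (2 * (n : ℝ) - a - b) / 2 - (n - a) / 2 = (n - b) / 2 by ring]
  simp only [one_rpow]
  congr 1
  field_simp

lemma lintegral_fin_prod_eq_prod {m : ℕ} {X : Type*} [MeasureSpace X]
    [SigmaFinite (volume : Measure X)] (f : Fin m → X → ℝ≥0∞) (hf : ∀ k, Measurable (f k)) :
    ∫⁻ y : Fin m → X, ∏ k, f k (y k) = ∏ k, ∫⁻ x, f k x := by
  induction m with
  | zero => simp [volume_pi]
  | succ m ih =>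
    rw [← (volume_preserving_piFinSuccAbove (fun _ : Fin (m + 1) => X) 0).symm.lintegral_comp
      (by fun_prop), Measure.volume_eq_prod]
    simp only [MeasurableEquiv.piFinSuccAbove_symm_apply, Fin.insertNthEquiv,
      Fin.prod_univ_succ, Fin.insertNth_zero, Equiv.coe_fn_mk, Fin.cons_succ, Fin.cons_zero,
      Fin.zero_succAbove, cast_eq]
    rw [lintegral_prod_mul (g := fun y : Fin m → X => ∏ k : Fin m, f k.succ (y k))
      (hf 0).aemeasurable (Measurable.aemeasurable (by fun_prop)), ih _ fun k => hf k.succ]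

lemma lintegral_lintegral_sq {X Y : Type*} [MeasurableSpace X] [MeasurableSpace Y]
    {μ : Measure X} {ν : Measure Y} [SFinite μ] [SFinite ν] {f : Y → X → ℝ≥0∞}
    (hf : Measurable (Function.uncurry f)) :
    ∫⁻ y, (∫⁻ x, f y x ∂μ) ^ 2 ∂ν = ∫⁻ x, ∫⁻ z, ∫⁻ y, f y x * f y z ∂ν ∂μ ∂μ := by
  have hfr : ∀ y, Measurable (f y) := fun y => hf.comp measurable_prodMk_left
  have hjoint : Measurable fun p : (Y × X) × X => f p.1.1 p.1.2 * f p.1.1 p.2 :=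
    (hf.comp measurable_fst).mul
      (hf.comp ((measurable_fst.comp measurable_fst).prodMk measurable_snd))
  calc
    _ = ∫⁻ y, ∫⁻ x, ∫⁻ z, f y x * f y z ∂μ ∂μ ∂ν := by
      refine lintegral_congr fun y => ?_
      rw [sq, ← lintegral_mul_const _ (hfr y)]
      exact lintegral_congr fun x => (lintegral_const_mul _ (hfr y)).symm
    _ = ∫⁻ x, ∫⁻ y, ∫⁻ z, f y x * f y z ∂μ ∂ν ∂μ :=
      lintegral_lintegral_swap hjoint.lintegral_prod_right'.aemeasurable
    _ = _ :=
      lintegral_congr fun x => lintegral_lintegral_swap (hjoint.comp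
        ((measurable_fst.prodMk measurable_const).prodMk measurable_snd)).aemeasurable

lemma lintegral_steinWeiss_kernel (hn : 1 ≤ n) {β : ℝ} (hβ : 0 < β) (hβn : β < n)
    {x : EuclideanSpace ℝ (Fin n)} (hx : x ≠ 0) :
    ∫⁻ z, ENNReal.ofReal (‖x‖ ^ ((n - β) / 2) * (‖z - x‖ ^ (-(n - β)) * ‖z‖ ^ (-((n + β) / 2)))) =
      ENNReal.ofReal (π ^ ((n : ℝ) / 2) * (Gamma (β / 2) / Gamma ((n - β) / 2)) *
        (Gamma ((n - β) / 4) / Gamma ((n + β) / 4)) ^ 2) := by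
  have hx' : 0 < ‖x‖ := norm_pos_iff.2 hx
  have h := lintegral_norm_sub_rpow_mul_norm_sub_rpow hn (a := n - β) (b := (n + β) / 2)
    (by linarith) (by linarith) (by linarith) hx
  simp only [sub_zero] at h
  simp only [ENNReal.ofReal_mul (rpow_nonneg hx'.le ((n - β) / 2))]
  rw [lintegral_const_mul _ (by fun_prop), h, ← ENNReal.ofReal_mul (by positivity)]
  congr 1
  rw [show (n : ℝ) - (n - β) - (n + β) / 2 = -((n - β) / 2) by ring, rpow_neg hx'.le,
    show ((n : ℝ) - (n - β)) / 2 = β / 2 by ring,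
    show ((n : ℝ) - (n + β) / 2) / 2 = (n - β) / 4 by ring,
    show ((n : ℝ) - β + (n + β) / 2 - n) / 2 = (n - β) / 4 by ring,
    show ((n : ℝ) + β) / 2 / 2 = (n + β) / 4 by ring,
    show (2 * (n : ℝ) - (n - β) - (n + β) / 2) / 2 = (n + β) / 4 by ring]
  have := (rpow_pos_of_pos hx' ((n - β) / 2)).ne'
  field_simp

/-- The diagonal Stein–Weiss inequality on `L²`, by Schur's test with weight `‖x‖ ^ (-n / 2)`. -/
lemma lintegral_lintegral_steinWeiss_le (hn : 1 ≤ n) {β : ℝ} (hβ : 0 < β) (hβn : β < n)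
    {g : EuclideanSpace ℝ (Fin n) → ℝ} (hg : Measurable g) :
    ∫⁻ x, ∫⁻ z, ENNReal.ofReal
        (‖x - z‖ ^ (-(n - β)) * (‖x‖ ^ (-(β / 2)) * g x) * (‖z‖ ^ (-(β / 2)) * g z)) ≤
      ENNReal.ofReal (π ^ ((n : ℝ) / 2) * (Gamma (β / 2) / Gamma ((n - β) / 2)) *
        (Gamma ((n - β) / 4) / Gamma ((n + β) / 4)) ^ 2) * ∫⁻ x, ENNReal.ofReal (g x ^ 2) := by
  have : Nonempty (Fin n) := ⟨⟨0, hn⟩⟩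
  set E := π ^ ((n : ℝ) / 2) * (Gamma (β / 2) / Gamma ((n - β) / 2)) *
        (Gamma ((n - β) / 4) / Gamma ((n + β) / 4)) ^ 2
  let T : EuclideanSpace ℝ (Fin n) → EuclideanSpace ℝ (Fin n) → ℝ := fun x z =>
    ‖x‖ ^ ((n - β) / 2) * (‖z - x‖ ^ (-(n - β)) * ‖z‖ ^ (-((n + β) / 2)))
  have hT : Measurable (Function.uncurry T) := by unfold T; fun_prop
  have hTr : ∀ x, Measurable (T x) := fun x => by unfold T; fun_prop
  have hT0 : ∀ x z, 0 ≤ T x z := fun x z => by positivity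
  let F : EuclideanSpace ℝ (Fin n) → EuclideanSpace ℝ (Fin n) → ℝ≥0∞ := fun x z =>
    ENNReal.ofReal (g x ^ 2 / 2) * ENNReal.ofReal (T x z)
  have hF : Measurable (Function.uncurry F) := by
    unfold F Function.uncurry
    exact ((by fun_prop : Measurable fun p : EuclideanSpace ℝ (Fin n) × EuclideanSpace ℝ (Fin n) =>
      ENNReal.ofReal (g p.1 ^ 2 / 2))).mul hT.ennreal_ofReal
  have hFint : ∫⁻ x, ∫⁻ z, F x z = ENNReal.ofReal E * ∫⁻ x, ENNReal.ofReal (g x ^ 2 / 2) := by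
    rw [← lintegral_const_mul _ (by fun_prop)]
    refine lintegral_congr_ae ?_
    filter_upwards [Measure.ae_ne volume 0] with x hx
    rw [lintegral_const_mul _ (hTr x).ennreal_ofReal, lintegral_steinWeiss_kernel hn hβ hβn hx,
      mul_comm]
  have key : ∀ x z : EuclideanSpace ℝ (Fin n), x ≠ 0 → z ≠ 0 → ENNReal.ofReal
      (‖x - z‖ ^ (-(n - β)) * (‖x‖ ^ (-(β / 2)) * g x) * (‖z‖ ^ (-(β / 2)) * g z)) ≤
      F x z + F z x := by
    intro x z hx hz
    have hx' : 0 < ‖x‖ := norm_pos_iff.2 hx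
    have hz' : 0 < ‖z‖ := norm_pos_iff.2 hz
    have hTx := hT0 x z
    have hTz := hT0 z x
    simp only [F]
    rw [← ENNReal.ofReal_mul (by positivity), ← ENNReal.ofReal_mul (by positivity),
      ← ENNReal.ofReal_add (by positivity) (by positivity)]
    refine ENNReal.ofReal_le_ofReal ?_
    have e₁ : (((n : ℝ) - β) / 2) = -(β / 2) + n / 4 + n / 4 := by ring
    have e₂ : -(((n : ℝ) + β) / 2) = -(β / 2) + -(n / 4) + -(n / 4) := by ring
    simp only [T, norm_sub_rev z x, e₁, e₂, rpow_add hx', rpow_add hz', rpow_neg hx'.le (n / 4),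
      rpow_neg hz'.le (n / 4)]
    have hX := rpow_pos_of_pos hx' (n / 4 : ℝ)
    have hZ := rpow_pos_of_pos hz' (n / 4 : ℝ)
    set X := ‖x‖ ^ (n / 4 : ℝ)
    set Z := ‖z‖ ^ (n / 4 : ℝ)
    have hC : 0 ≤ ‖x - z‖ ^ (-(n - β)) * ‖x‖ ^ (-(β / 2)) * ‖z‖ ^ (-(β / 2)) := by positivity
    have hsq : X * X⁻¹ * (Z * Z⁻¹) = 1 := by field_simp
    linear_combination (1 / 2 : ℝ) * mul_nonneg hC (sq_nonneg (g x * (X * Z⁻¹) - g z * (Z * X⁻¹))) +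
      ‖x - z‖ ^ (-(n - β)) * ‖x‖ ^ (-(β / 2)) * ‖z‖ ^ (-(β / 2)) * g x * g z * (-hsq)
  calc
    _ ≤ ∫⁻ x, ∫⁻ z, (F x z + F z x) := by
      refine lintegral_mono_ae ?_
      filter_upwards [Measure.ae_ne volume 0] with x hx
      refine lintegral_mono_ae ?_
      filter_upwards [Measure.ae_ne volume 0] with z hz using key x z hx hz
    _ = (∫⁻ x, ∫⁻ z, F x z) + ∫⁻ x, ∫⁻ z, F z x := by
      rw [← lintegral_add_left hF.lintegral_prod_right]
      refine lintegral_congr fun x => lintegral_add_left (hF.comp measurable_prodMk_left) _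
    _ = 2 * ∫⁻ x, ∫⁻ z, F x z := by
      rw [two_mul, lintegral_lintegral_swap (f := fun x z => F z x)
        (hF.comp measurable_swap).aemeasurable]
    _ = _ := by
      rw [hFint, mul_left_comm, ← lintegral_const_mul _ (by fun_prop)]
      congr 1
      refine lintegral_congr fun x => ?_
      rw [← ENNReal.ofReal_ofNat 2, ← ENNReal.ofReal_mul (by norm_num)]
      congr 1
      ring

lemma lintegral_prod_norm_sub_rpow (hn : 1 ≤ n) {m : ℕ} {α : Fin m → ℝ}
    (hα : ∀ k, 0 < α k ∧ α k < n) {x z : EuclideanSpace ℝ (Fin n)} (hxz : x ≠ z) :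
    ∫⁻ y : Fin m → EuclideanSpace ℝ (Fin n),
        ∏ k, ENNReal.ofReal (‖y k - x‖ ^ (α k / 2 - n) * ‖y k - z‖ ^ (α k / 2 - n)) =
      ENNReal.ofReal (π ^ ((m : ℝ) * n / 2) *
          (∏ k, Gamma (α k / 4) ^ 2 * Gamma ((n - α k) / 2) /
            (Gamma ((2 * n - α k) / 4) ^ 2 * Gamma (α k / 2))) *
        ‖x - z‖ ^ ((∑ k, α k) - m * n)) := by
  have hr : 0 < ‖x - z‖ := norm_pos_iff.2 (sub_ne_zero.2 hxz)
  rw [lintegral_fin_prod_eq_prod (fun k y => ENNReal.ofReal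
    (‖y - x‖ ^ (α k / 2 - n) * ‖y - z‖ ^ (α k / 2 - n))) fun k => by fun_prop]
  have hk : ∀ k, ∫⁻ y, ENNReal.ofReal (‖y - x‖ ^ (α k / 2 - n) * ‖y - z‖ ^ (α k / 2 - n)) =
      ENNReal.ofReal (π ^ ((n : ℝ) / 2) * (Gamma (α k / 4) ^ 2 * Gamma ((n - α k) / 2) /
            (Gamma ((2 * n - α k) / 4) ^ 2 * Gamma (α k / 2))) * ‖x - z‖ ^ (α k - n)) := by
    intro k
    obtain ⟨h0, h1⟩ := hα k
    have h := lintegral_norm_sub_rpow_mul_norm_sub_rpow hn (a := n - α k / 2) (b := n - α k / 2)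
      (by linarith) (by linarith) (by linarith) hxz
    rw [neg_sub] at h
    rw [h, show ((n : ℝ) - (n - α k / 2)) / 2 = α k / 4 by ring,
      show ((n : ℝ) - α k / 2 + (n - α k / 2) - n) / 2 = (n - α k) / 2 by ring,
      show ((n : ℝ) - α k / 2) / 2 = (2 * n - α k) / 4 by ring,
      show (2 * (n : ℝ) - (n - α k / 2) - (n - α k / 2)) / 2 = α k / 2 by ring,
      show (n : ℝ) - (n - α k / 2) - (n - α k / 2) = α k - n by ring, sq, sq]
  rw [Finset.prod_congr rfl fun k _ => hk k, ← ENNReal.ofReal_prod_of_nonneg]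
  · rw [Finset.prod_mul_distrib, Finset.prod_mul_distrib, ← rpow_sum_of_pos hr,
      Finset.sum_sub_distrib, Finset.prod_const, ← rpow_natCast, ← rpow_mul pi_pos.le]
    simp only [Finset.card_univ, Fintype.card_fin, Finset.sum_const, nsmul_eq_mul]
    ring_nf
  · intro k _
    obtain ⟨h0, h1⟩ := hα k
    have h₁ := Gamma_pos_of_pos (show 0 < (n - α k) / 2 by linarith)
    have h₂ := Gamma_pos_of_pos (show 0 < α k / 2 by linarith)
    positivity


/-- **Dual form of the multilinear Pitt inequality.**
For `0 < α_k < n`, `(m−1)n < α = Σ α_k < mn`, `β = α − (m−1)n`,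
and nonnegative measurable `g` on `ℝ^n`,
`∫ (∫ Π_k |y_k−x|^{−(n−α_k/2)} |x|^{−β/2} g(x) dx)² dy ≤ D_β ∫ g²`. -/
theorem stmt7 (m n : ℕ) (hm : 1 ≤ m) (hn : 1 ≤ n)
    (α : Fin m → ℝ) (hα : ∀ k, 0 < α k ∧ α k < n)
    (hlow : ((m : ℝ) - 1) * n < ∑ k, α k) (hhigh : (∑ k, α k) < m * n)
    (β : ℝ) (hβ : β = (∑ k, α k) - ((m : ℝ) - 1) * n)
    (g : EuclideanSpace ℝ (Fin n) → ℝ)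
    (hg : Measurable g) (hg0 : ∀ x, 0 ≤ g x) :
    (∫⁻ y : Fin m → EuclideanSpace ℝ (Fin n),
        (∫⁻ x : EuclideanSpace ℝ (Fin n),
          (∏ k, ENNReal.ofReal (‖y k - x‖ ^ (α k / 2 - n))) *
            ENNReal.ofReal (‖x‖ ^ (-(β / 2))) * ENNReal.ofReal (g x)) ^ (2 : ℕ)) ≤
      ENNReal.ofReal
        (Real.pi ^ (((m : ℝ) + 1) * n / 2) *
          (∏ k, Real.Gamma (α k / 4) ^ 2 * Real.Gamma (((n : ℝ) - α k) / 2) /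
            (Real.Gamma ((2 * (n : ℝ) - α k) / 4) ^ 2 * Real.Gamma (α k / 2))) *
          (Real.Gamma (β / 2) / Real.Gamma (((n : ℝ) - β) / 2)) *
          (Real.Gamma (((n : ℝ) - β) / 4) / Real.Gamma (((n : ℝ) + β) / 4)) ^ 2) *
        ∫⁻ x, ENNReal.ofReal (g x) ^ (2 : ℕ) := by
  have : Nonempty (Fin n) := ⟨⟨0, hn⟩⟩
  have hβ0 : 0 < β := by rw [hβ]; linarith
  have hβn : β < n := by rw [hβ]; linarith
  set P : ℝ := ∏ k, Gamma (α k / 4) ^ 2 * Gamma (((n : ℝ) - α k) / 2) /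
    (Gamma ((2 * (n : ℝ) - α k) / 4) ^ 2 * Gamma (α k / 2)) with hP
  have hP0 : 0 ≤ P := Finset.prod_nonneg fun k _ => by
    obtain ⟨h0, h1⟩ := hα k
    have h₁ := Gamma_pos_of_pos (show 0 < (n - α k) / 2 by linarith)
    have h₂ := Gamma_pos_of_pos (show 0 < α k / 2 by linarith)
    positivity
  let w : EuclideanSpace ℝ (Fin n) → ℝ := fun x => ‖x‖ ^ (-(β / 2)) * g x
  have hw0 : ∀ x, 0 ≤ w x := fun x => mul_nonneg (by positivity) (hg0 x)
  have hmeas : Measurable (Function.uncurry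
      fun (y : Fin m → EuclideanSpace ℝ (Fin n)) (x : EuclideanSpace ℝ (Fin n)) =>
        (∏ k, ENNReal.ofReal (‖y k - x‖ ^ (α k / 2 - n))) *
          ENNReal.ofReal (‖x‖ ^ (-(β / 2))) * ENNReal.ofReal (g x)) := by
    unfold Function.uncurry
    fun_prop
  have inner : ∀ x z : EuclideanSpace ℝ (Fin n), x ≠ z →
      ∫⁻ y : Fin m → EuclideanSpace ℝ (Fin n),
        (∏ k, ENNReal.ofReal (‖y k - x‖ ^ (α k / 2 - n))) *
          ENNReal.ofReal (‖x‖ ^ (-(β / 2))) * ENNReal.ofReal (g x) *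
        ((∏ k, ENNReal.ofReal (‖y k - z‖ ^ (α k / 2 - n))) *
          ENNReal.ofReal (‖z‖ ^ (-(β / 2))) * ENNReal.ofReal (g z)) =
      ENNReal.ofReal (π ^ ((m : ℝ) * n / 2) * P) *
        ENNReal.ofReal (‖x - z‖ ^ (-(n - β)) * w x * w z) := by
    intro x z hxz
    have h := lintegral_prod_norm_sub_rpow hn hα hxz
    rw [← hP, show (∑ k, α k) - m * n = -(n - β) by rw [hβ]; ring] at h
    calc
      _ = ∫⁻ y : Fin m → EuclideanSpace ℝ (Fin n), ENNReal.ofReal (w x * w z) *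
          ∏ k, ENNReal.ofReal (‖y k - x‖ ^ (α k / 2 - n) * ‖y k - z‖ ^ (α k / 2 - n)) := by
        refine lintegral_congr fun y => ?_
        simp only [ENNReal.ofReal_mul (hw0 x), w,
          ENNReal.ofReal_mul (rpow_nonneg (norm_nonneg _) _), Finset.prod_mul_distrib]
        ring
      _ = _ := by
        have := hw0 x
        have := hw0 z
        rw [lintegral_const_mul' _ _ ENNReal.ofReal_ne_top, h,
          ← ENNReal.ofReal_mul (by positivity), ← ENNReal.ofReal_mul (by positivity)]
        ring_nf
  have hexpand : ∀ x : EuclideanSpace ℝ (Fin n), ∫⁻ z, ∫⁻ y : Fin m → EuclideanSpace ℝ (Fin n),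
        (∏ k, ENNReal.ofReal (‖y k - x‖ ^ (α k / 2 - n))) *
          ENNReal.ofReal (‖x‖ ^ (-(β / 2))) * ENNReal.ofReal (g x) *
        ((∏ k, ENNReal.ofReal (‖y k - z‖ ^ (α k / 2 - n))) *
          ENNReal.ofReal (‖z‖ ^ (-(β / 2))) * ENNReal.ofReal (g z)) =
      ENNReal.ofReal (π ^ ((m : ℝ) * n / 2) * P) *
        ∫⁻ z, ENNReal.ofReal (‖x - z‖ ^ (-(n - β)) * w x * w z) := by
    intro x
    rw [← lintegral_const_mul' _ _ ENNReal.ofReal_ne_top]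
    refine lintegral_congr_ae ?_
    filter_upwards [Measure.ae_ne volume x] with z hz
    exact inner x z hz.symm
  rw [lintegral_lintegral_sq hmeas, lintegral_congr hexpand,
    lintegral_const_mul' _ _ ENNReal.ofReal_ne_top]
  refine (mul_le_mul_right (lintegral_lintegral_steinWeiss_le hn hβ0 hβn hg) _).trans_eq ?_
  rw [← mul_assoc, ← ENNReal.ofReal_mul (by positivity)]
  simp only [ENNReal.ofReal_pow (hg0 _)]
  congr 2
  rw [show ((m : ℝ) + 1) * n / 2 = m * n / 2 + n / 2 by ring, rpow_add pi_pos]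
  ring
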